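/- Let (W, S) be a Coxeter system with S finite, ε an automorphism of W, and J, J' ⊆ S with ε(J) = J'. The map φ sending (J_n, J'_n, u_n)_{n≥0} ∈ S(J, ε) to the eventually-stable product u_0 u_1 ⋯ u_m (m ≫ 0) is a well-defined bijection from S(J, ε) onto {}^{J'}W, the set of minimal length representatives of right cosets W_{J'} w. -/

import Mathlib

namespace Lusztig

variable {B : Type*} {W : Type*} [Group W] {M : CoxeterMatrix B}

/-- The standard parabolic subgroup `W_K` generated by the simple reflections in `K`. -/
def WP (cs : CoxeterSystem M W) (K : Set B) : Subgroup W :=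
  Subgroup.closure (cs.simple '' K)

/-- `w` is the unique minimal length element of its left coset `W_K w`
(i.e. `w ∈ ᴷW`). -/
def IsMinL (cs : CoxeterSystem M W) (K : Set B) (w : W) : Prop :=
  ∀ a ∈ WP cs K, a * w ≠ w → cs.length w < cs.length (a * w)

/-- `w` is the unique minimal length element of its right coset `w W_K`
(i.e. `w ∈ Wᴷ`). -/
def IsMinR (cs : CoxeterSystem M W) (K : Set B) (w : W) : Prop :=
  ∀ b ∈ WP cs K, w * b ≠ w → cs.length w < cs.length (w * b)

/-- `x` is the unique minimal length element of its double coset `W_K x W_{K'}`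
(i.e. `x ∈ ᴷWᴷ'`). -/
def IsMinDC (cs : CoxeterSystem M W) (K K' : Set B) (x : W) : Prop :=
  ∀ a ∈ WP cs K, ∀ b ∈ WP cs K', a * x * b ≠ x → cs.length x < cs.length (a * x * b)

/-- `x` is the unique minimal length element of the double coset `W_K g W_{K'}`. -/
def IsMinOf (cs : CoxeterSystem M W) (K K' : Set B) (g x : W) : Prop :=
  (∃ a ∈ WP cs K, ∃ b ∈ WP cs K', x = a * g * b) ∧
  ∀ a ∈ WP cs K, ∀ b ∈ WP cs K', a * g * b ≠ x → cs.length x < cs.length (a * g * b)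

/-- `Ad(x)J ∩ S`, as a set of indices of simple reflections:
the set of `s` with `simple s = x * (simple t) * x⁻¹` for some `t ∈ J`. -/
def AdSet (cs : CoxeterSystem M W) (x : W) (J : Set B) : Set B :=
  {s | ∃ t ∈ J, cs.simple s = x * cs.simple t * x⁻¹}

/-- The product `u 0 * u 1 * ⋯ * u (n-1)`. -/
def pr (u : ℕ → W) (n : ℕ) : W := ((List.range n).map u).prod

/-- Lusztig's set `S(J, ε)` (2.3): sequences `(J_n, J'_n, u_n)` with
`J = J_0 ⊇ J_1 ⊇ ⋯`, `ε(J_n) = ε(J_{n-1}) ∩ Ad(u_0⋯u_{n-1})J_{n-1}` (n ≥ 1),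
`J'_0 = ε(J) = J'`, `J'_n = J_{n-1} ∩ Ad(u_0⋯u_{n-1})⁻¹ε(J_{n-1})` (n ≥ 1),
`u_n ∈ W_{J_{n-1}}` (n ≥ 1), `u_n ∈ {}^{J'_n}W ∩ W^{J_n}` (n ≥ 0).
Here `ε` is encoded by its restriction `f : B ≃ B` to the simple reflections. -/
structure SSeq (cs : CoxeterSystem M W) (f : B ≃ B) (J : Set B) where
  Jn : ℕ → Set B
  J'n : ℕ → Set B
  u : ℕ → W
  hJ0 : Jn 0 = J
  hJ'0 : J'n 0 = f '' J
  hmono : ∀ n, Jn (n + 1) ⊆ Jn n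
  hb : ∀ n, f '' Jn (n + 1) = (f '' Jn n) ∩ AdSet cs (pr u (n + 1)) (Jn n)
  hc : ∀ n, J'n (n + 1) = Jn n ∩ AdSet cs (pr u (n + 1))⁻¹ (f '' Jn n)
  hd : ∀ n, u (n + 1) ∈ WP cs (Jn n)
  he : ∀ n, IsMinL cs (J'n n) (u n) ∧ IsMinR cs (Jn n) (u n)

/-- Lusztig's set `T(J, ε)` (2.2): sequences `(J_n, w_n)` with
`J = J_0 ⊇ J_1 ⊇ ⋯`, `J_n = J_{n-1} ∩ ε⁻¹(Ad(w_{n-1})J_{n-1})` (n ≥ 1),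
`w_n ∈ {}^{ε(J_n)}W^{J_n}` (n ≥ 0), `w_n ∈ W_{ε(J_n)} w_{n-1} W_{J_{n-1}}` (n ≥ 1). -/
structure TSeq (cs : CoxeterSystem M W) (f : B ≃ B) (J : Set B) where
  Jn : ℕ → Set B
  w : ℕ → W
  hJ0 : Jn 0 = J
  hmono : ∀ n, Jn (n + 1) ⊆ Jn n
  hb : ∀ n, Jn (n + 1) = Jn n ∩ f.symm '' AdSet cs (w n) (Jn n)
  hc : ∀ n, IsMinDC cs (f '' Jn n) (Jn n) (w n)
  hd : ∀ n, ∃ a ∈ WP cs (f '' Jn (n + 1)), ∃ b ∈ WP cs (Jn n), w (n + 1) = a * w n * b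

section Exchange

open CoxeterSystem

open scoped Classical in
/-- The elementary permutation-type maps on `W × ZMod 2`. -/
noncomputable def sg (cs : CoxeterSystem M W) (i : B) : Function.End (W × ZMod 2) :=
  fun p => (cs.simple i * p.1 * cs.simple i, p.2 + if p.1 = cs.simple i then 1 else 0)

open scoped Classical in
theorem sg_word (cs : CoxeterSystem M W) (ω : List B) (p : W × ZMod 2) :
    (ω.map (sg cs)).prod p =
      (cs.wordProd ω * p.1 * (cs.wordProd ω)⁻¹, p.2 + ((cs.rightInvSeq ω).count p.1 : ZMod 2)) := by
  induction ω with
  | nil =>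
    simp only [List.map_nil, List.prod_nil, wordProd_nil, rightInvSeq_nil, List.count_nil]
    change p = _
    simp
  | cons i ω ih =>
    rw [List.map_cons, List.prod_cons]
    change sg cs i ((ω.map (sg cs)).prod p) = _
    rw [ih]
    simp only [sg, rightInvSeq, List.count_cons, wordProd_cons]
    ext
    · simp [mul_assoc]
    · have h : (cs.wordProd ω * p.1 * (cs.wordProd ω)⁻¹ = cs.simple i) ↔
          ((cs.wordProd ω)⁻¹ * cs.simple i * cs.wordProd ω = p.1) := by
        constructor
        · intro h; rw [← h]; group
        · intro h; rw [← h]; group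
      simp only [h, beq_iff_eq]
      push_cast
      split_ifs <;> simp [add_assoc]

open scoped Classical in
theorem count_alt (cs : CoxeterSystem M W) (i j : B) (t : W) :
    ((cs.rightInvSeq (alternatingWord i j (2 * M i j))).count t : ZMod 2) = 0 := by
  have h1 : cs.rightInvSeq (alternatingWord i j (2 * M i j)) =
      (cs.leftInvSeq (alternatingWord i j (2 * M i j)).reverse).reverse := by
    rw [leftInvSeq_reverse, List.reverse_reverse]
  set ω := alternatingWord i j (2 * M i j) with hω
  have hlen : (cs.leftInvSeq ω).length = 2 * M i j := by simp [hω]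
  have key : (cs.leftInvSeq ω).take (M i j) = (cs.leftInvSeq ω).drop (M i j) := by
    apply List.ext_getElem
    · simp [hlen]; omega
    · intro k hk1 hk2
      rw [List.getElem_take, List.getElem_drop]
      have hk : k < M i j := by simp at hk1; omega
      rw [getElem_leftInvSeq_alternatingWord cs i j (M i j) k (by omega),
        getElem_leftInvSeq_alternatingWord cs i j (M i j) (M i j + k) (by omega)]
      simp only [prod_alternatingWord_eq_mul_pow]
      have e1 : (2 * k + 1) / 2 = k := by omega
      have e2 : (2 * (M i j + k) + 1) / 2 = M i j + k := by omega
      have o1 : ¬ Even (2 * k + 1) := by simp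
      have o2 : ¬ Even (2 * (M i j + k) + 1) := by simp
      simp [e1, e2, o1, o2, pow_add]
  have hcl : ((cs.leftInvSeq ω).count t : ZMod 2) = 0 := by
    rw [← List.take_append_drop (M i j) (cs.leftInvSeq ω), List.count_append, key]
    push_cast
    exact CharTwo.add_self_eq_zero _
  have hone : cs.wordProd ω = 1 := by
    rw [hω, prod_alternatingWord_eq_mul_pow]; simp
  have hr : cs.rightInvSeq ω = cs.leftInvSeq ω := by
    apply List.ext_getElem
    · simp
    · intro k hk1 hk2
      have hk : k < ω.length := by simpa using hk1
      have a := cs.wordProd_mul_getD_rightInvSeq ω k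
      have b := cs.getD_leftInvSeq_mul_wordProd ω k
      rw [hone] at a b
      rw [one_mul] at a
      rw [mul_one] at b
      rw [List.getD_eq_getElem _ _ hk1] at a
      rw [List.getD_eq_getElem _ _ hk2] at b
      rw [a, b]
  rw [hr, hcl]

theorem sg_liftable (cs : CoxeterSystem M W) : M.IsLiftable (sg cs) := by
  classical
  intro i j
  have h : (sg cs i * sg cs j) ^ M i j = ((alternatingWord i j (2 * M i j)).map (sg cs)).prod := by
    have : ∀ m : ℕ, (sg cs i * sg cs j) ^ m = ((alternatingWord i j (2 * m)).map (sg cs)).prod := by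
      intro m
      induction m with
      | zero => simp [alternatingWord]
      | succ m ih =>
        rw [show 2 * (m + 1) = 2 * m + 1 + 1 by ring, alternatingWord_succ', alternatingWord_succ']
        simp [pow_succ', ih, mul_assoc]
    exact this _
  rw [h]
  funext p
  rw [sg_word, count_alt, prod_alternatingWord_eq_mul_pow]
  change _ = p
  simp

open scoped Classical in
theorem count_eq (cs : CoxeterSystem M W) (ω ω' : List B) (h : cs.wordProd ω = cs.wordProd ω')
    (t : W) : ((cs.rightInvSeq ω).count t : ZMod 2) = ((cs.rightInvSeq ω').count t : ZMod 2) := by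
  have hl : ∀ ω : List B, (ω.map (sg cs)).prod = cs.lift ⟨sg cs, sg_liftable cs⟩ (cs.wordProd ω) := by
    intro ω
    induction ω with
    | nil => simp
    | cons i ω ih =>
      rw [wordProd_cons, map_mul, ← ih, List.map_cons, List.prod_cons, lift_apply_simple]
  have := congrArg Prod.snd (congrFun ((hl ω).trans ((congrArg _ h).trans (hl ω').symm)) (t, 0))
  simpa [sg_word] using this

theorem exR (cs : CoxeterSystem M W) (ω : List B) (i : B) (h : cs.IsRightDescent (cs.wordProd ω) i) :
    ∃ ω', ω'.Sublist ω ∧ ω'.length + 1 = ω.length ∧ cs.wordProd ω' = cs.wordProd ω * cs.simple i := by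
  classical
  obtain ⟨τ, hτ, hτe⟩ := cs.exists_isReduced (cs.wordProd ω * cs.simple i)
  have hp : cs.wordProd (τ.concat i) = cs.wordProd ω := by
    rw [wordProd_concat, ← hτe]; simp
  have hred : cs.IsReduced (τ.concat i) := by
    have h2 := (cs.isRightDescent_iff).1 h
    rw [hτe, hτ.eq] at h2
    unfold CoxeterSystem.IsReduced
    rw [hp, ← h2]; simp
  have hm : cs.simple i ∈ cs.rightInvSeq (τ.concat i) := by
    rw [rightInvSeq_concat]; simp
  have hc : (cs.rightInvSeq (τ.concat i)).count (cs.simple i) = 1 :=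
    List.count_eq_one_of_mem hred.nodup_rightInvSeq hm
  have hc2 := count_eq cs _ _ hp (cs.simple i)
  rw [hc] at hc2
  have hmem : cs.simple i ∈ cs.rightInvSeq ω := by
    by_contra hn
    rw [List.count_eq_zero_of_not_mem hn] at hc2
    simp at hc2
  obtain ⟨k, hk, hke⟩ := List.getElem_of_mem hmem
  refine ⟨ω.eraseIdx k, List.eraseIdx_sublist _ _, ?_, ?_⟩
  · simp at hk
    rw [List.length_eraseIdx]; simp [hk]; omega
  · have := cs.wordProd_mul_getD_rightInvSeq ω k
    rw [List.getD_eq_getElem _ _ hk, hke] at this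
    exact this.symm

theorem exL (cs : CoxeterSystem M W) (ω : List B) (i : B) (h : cs.IsLeftDescent (cs.wordProd ω) i) :
    ∃ ω', ω'.Sublist ω ∧ ω'.length + 1 = ω.length ∧ cs.wordProd ω' = cs.simple i * cs.wordProd ω := by
  have h' : cs.IsRightDescent (cs.wordProd ω.reverse) i := by
    rw [wordProd_reverse]; exact (cs.isRightDescent_inv_iff).2 h
  obtain ⟨τ, h1, h2, h3⟩ := exR cs _ i h'
  refine ⟨τ.reverse, by simpa using h1.reverse, by simpa using h2, ?_⟩
  rw [wordProd_reverse, h3, wordProd_reverse]; simp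

theorem exists_reduced_sublist (cs : CoxeterSystem M W) (ω : List B) :
    ∃ ω', ω'.Sublist ω ∧ cs.IsReduced ω' ∧ cs.wordProd ω' = cs.wordProd ω := by
  induction ω with
  | nil => exact ⟨[], by simp, by simp [CoxeterSystem.IsReduced], rfl⟩
  | cons i ω ih =>
    obtain ⟨τ, h1, h2, h3⟩ := ih
    by_cases hd : cs.IsLeftDescent (cs.wordProd τ) i
    · obtain ⟨ρ, k1, k2, k3⟩ := exL cs τ i hd
      refine ⟨ρ, (k1.trans h1).trans (List.sublist_cons_self _ _), ?_, ?_⟩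
      · have := (cs.isLeftDescent_iff).1 hd
        rw [h2.eq] at this
        unfold CoxeterSystem.IsReduced
        rw [k3]; omega
      · rw [k3, h3, wordProd_cons]
    · refine ⟨i :: τ, h1.cons_cons i, ?_, ?_⟩
      · have := (cs.not_isLeftDescent_iff).1 hd
        unfold CoxeterSystem.IsReduced
        rw [wordProd_cons, this, h2.eq]; simp
      · rw [wordProd_cons, wordProd_cons, h3]

end Exchange

section Parabolic

open CoxeterSystem

theorem WP_mono (cs : CoxeterSystem M W) {K L : Set B} (h : K ⊆ L) : WP cs K ≤ WP cs L :=
  Subgroup.closure_mono (Set.image_mono h)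

theorem simple_mem_WP (cs : CoxeterSystem M W) {K : Set B} {i : B} (h : i ∈ K) :
    cs.simple i ∈ WP cs K := Subgroup.subset_closure ⟨i, h, rfl⟩

theorem word_mem_WP (cs : CoxeterSystem M W) {K : Set B} (ω : List B) (h : ∀ i ∈ ω, i ∈ K) :
    cs.wordProd ω ∈ WP cs K := by
  induction ω with
  | nil => simp [one_mem]
  | cons i ω ih =>
    rw [wordProd_cons]
    exact mul_mem (simple_mem_WP cs (h i (by simp))) (ih fun j hj => h j (by simp [hj]))

theorem redK (cs : CoxeterSystem M W) {K : Set B} {a : W} (ha : a ∈ WP cs K) :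
    ∃ ω : List B, cs.IsReduced ω ∧ (∀ i ∈ ω, i ∈ K) ∧ cs.wordProd ω = a := by
  have h : ∃ ω : List B, (∀ i ∈ ω, i ∈ K) ∧ cs.wordProd ω = a := by
    unfold WP at ha
    induction ha using Subgroup.closure_induction with
    | mem x hx =>
      obtain ⟨i, hi, rfl⟩ := hx
      exact ⟨[i], by simpa using hi, by simp⟩
    | one => exact ⟨[], by simp, by simp⟩
    | mul x y _ _ hx hy =>
      obtain ⟨α, ha, rfl⟩ := hx
      obtain ⟨β, hb, rfl⟩ := hy
      refine ⟨α ++ β, ?_, wordProd_append _ _ _⟩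
      intro i hi
      rcases List.mem_append.1 hi with h | h
      exacts [ha i h, hb i h]
    | inv x _ hx =>
      obtain ⟨α, ha, rfl⟩ := hx
      exact ⟨α.reverse, by simpa using ha, wordProd_reverse _ _⟩
  obtain ⟨ω, h1, rfl⟩ := h
  obtain ⟨τ, k1, k2, k3⟩ := exists_reduced_sublist cs ω
  exact ⟨τ, k2, fun i hi => h1 i (k1.subset hi), k3⟩

theorem addR (cs : CoxeterSystem M W) {K : Set B} {u : W}
    (hu : ∀ b ∈ WP cs K, cs.length u ≤ cs.length (u * b)) (b : W) (hb : b ∈ WP cs K) :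
    cs.length (u * b) = cs.length u + cs.length b := by
  obtain ⟨ω, h1, h2, rfl⟩ := redK cs hb
  clear hb
  induction ω using List.reverseRecOn with
  | nil => simp
  | append_singleton τ i ih =>
    have hτ : cs.IsReduced τ := by simpa using h1.take τ.length
    have ih := ih hτ (fun j hj => h2 j (by simp [hj]))
    have hp : cs.wordProd (τ ++ [i]) = cs.wordProd τ * cs.simple i := by simp [wordProd_append]
    have hl := h1.eq
    rw [List.length_append, List.length_singleton] at hl
    rw [hl, hp, ← mul_assoc]
    rw [hp] at hl
    rw [hτ.eq] at ih
    rcases cs.length_mul_simple (u * cs.wordProd τ) i with h | h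
    · omega
    · exfalso
      obtain ⟨α, hα, hαu⟩ := cs.exists_isReduced u
      have hw : cs.wordProd (α ++ τ) = u * cs.wordProd τ := by rw [wordProd_append, ← hαu]
      have hd : cs.IsRightDescent (cs.wordProd (α ++ τ)) i := by
        rw [hw]; exact (cs.isRightDescent_iff).2 h
      obtain ⟨ρ, s1, s2, s3⟩ := exR cs _ i hd
      obtain ⟨α', τ', rfl, sα, sτ⟩ := List.sublist_append_iff.1 s1
      have lα := sα.length_le
      have lτ := sτ.length_le
      simp only [List.length_append] at s2
      rw [hw, wordProd_append] at s3
      rcases lτ.lt_or_eq with hlt | heq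
      · have : α' = α := sα.eq_of_length (by omega)
        subst this
        rw [← hαu, mul_assoc] at s3
        have s3 := mul_left_cancel s3
        have := cs.length_wordProd_le τ'
        rw [s3] at this
        omega
      · have : τ' = τ := sτ.eq_of_length heq
        subst this
        have hmem : cs.wordProd τ' * cs.simple i * (cs.wordProd τ')⁻¹ ∈ WP cs K :=
          mul_mem (mul_mem (word_mem_WP cs _ fun j hj => h2 j (by simp [hj]))
            (simple_mem_WP cs (h2 i (by simp))))
            (inv_mem (word_mem_WP cs _ fun j hj => h2 j (by simp [hj])))
        have h5 := hu _ hmem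
        have h6 : u * (cs.wordProd τ' * cs.simple i * (cs.wordProd τ')⁻¹) = cs.wordProd α' := by
          rw [eq_comm, ← mul_inv_eq_iff_eq_mul.2 s3.symm]
          group
        rw [h6] at h5
        have := cs.length_wordProd_le α'
        have := hα.eq
        rw [← hαu] at this
        omega

theorem IsMinR.add {cs : CoxeterSystem M W} {K : Set B} {u : W} (hu : IsMinR cs K u) (b : W)
    (hb : b ∈ WP cs K) : cs.length (u * b) = cs.length u + cs.length b := by
  refine addR cs (fun b hb => ?_) b hb
  by_cases h : u * b = u
  · rw [h]
  · exact (hu b hb h).le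

theorem exists_decomp (cs : CoxeterSystem M W) (K : Set B) (w : W) :
    ∃ u, IsMinR cs K u ∧ u⁻¹ * w ∈ WP cs K := by
  classical
  have hex : ∃ n, ∃ b ∈ WP cs K, cs.length (w * b) = n := ⟨_, 1, one_mem _, rfl⟩
  obtain ⟨b, hb, hn⟩ := Nat.find_spec hex
  refine ⟨w * b, ?_, by simpa [mul_assoc] using hb⟩
  intro c hc hne
  have := addR cs (K := K) (u := w * b) (fun d hd => by
    rw [hn, mul_assoc]
    exact Nat.find_min' hex ⟨b * d, mul_mem hb hd, rfl⟩) c hc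
  have h0 : cs.length c ≠ 0 := by
    intro h
    rw [cs.length_eq_zero_iff.1 h] at hne
    simp at hne
  omega

theorem isMinR_of (cs : CoxeterSystem M W) {K : Set B} {w : W}
    (h : ∀ i ∈ K, ¬ cs.IsRightDescent w i) : IsMinR cs K w := by
  obtain ⟨u, hu, hv⟩ := exists_decomp cs K w
  obtain ⟨ω, h1, h2, h3⟩ := redK cs hv
  rcases List.eq_nil_or_concat ω with rfl | ⟨τ, i, rfl⟩
  · have : w = u := by
      rw [wordProd_nil] at h3
      exact (inv_mul_eq_one.1 h3.symm).symm
    rwa [this]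
  · exfalso
    have hi : i ∈ K := h2 i (by simp)
    apply h i hi
    have hτ : ∀ j ∈ τ, j ∈ K := fun j hj => h2 j (by simp [hj])
    have e1 : w = u * cs.wordProd (τ.concat i) := by rw [h3]; group
    have e2 : w * cs.simple i = u * cs.wordProd τ := by
      rw [e1, wordProd_concat]; simp [mul_assoc]
    unfold IsRightDescent
    rw [e2, e1, hu.add _ (word_mem_WP cs _ hτ), hu.add _ (word_mem_WP cs _ h2), h1.eq]
    have := cs.length_wordProd_le τ
    simp; omega

theorem isMinL_iff_inv (cs : CoxeterSystem M W) {K : Set B} {w : W} :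
    IsMinL cs K w ↔ IsMinR cs K w⁻¹ := by
  constructor
  · intro h b hb hne
    have := h b⁻¹ (inv_mem hb) (fun h' => hne (by
      have := congrArg (·⁻¹) h'
      simpa using this))
    rwa [← cs.length_inv w, ← cs.length_inv (b⁻¹ * w), mul_inv_rev, inv_inv] at this
  · intro h b hb hne
    have := h b⁻¹ (inv_mem hb) (fun h' => hne (by
      have := congrArg (·⁻¹) h'
      simpa using this))
    rwa [← mul_inv_rev, cs.length_inv, cs.length_inv] at this

theorem isMinL_of (cs : CoxeterSystem M W) {K : Set B} {w : W}
    (h : ∀ i ∈ K, ¬ cs.IsLeftDescent w i) : IsMinL cs K w := by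
  rw [isMinL_iff_inv]
  apply isMinR_of
  intro i hi
  rw [cs.isRightDescent_inv_iff]
  exact h i hi

theorem IsMinL.not_desc {cs : CoxeterSystem M W} {K : Set B} {w : W} (h : IsMinL cs K w)
    {i : B} (hi : i ∈ K) : ¬ cs.IsLeftDescent w i := by
  intro hd
  have h1 := h _ (simple_mem_WP cs hi)
  unfold IsLeftDescent at hd
  by_cases he : cs.simple i * w = w
  · rw [he] at hd; omega
  · have := h1 he; omega

theorem eq_one_of_mem {cs : CoxeterSystem M W} {K : Set B} {w : W} (h : IsMinL cs K w)
    (hw : w ∈ WP cs K) : w = 1 := by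
  by_contra hne
  have := h w⁻¹ (inv_mem hw) (by simpa [eq_comm] using hne)
  simp at this

/-- Standard double coset lemma. -/
theorem minL_mul (cs : CoxeterSystem M W) {K K' : Set B} {u v : W} (hL : IsMinL cs K' u)
    (hR : IsMinR cs K u) (hv : v ∈ WP cs K)
    (hvm : ∀ t ∈ K, ∀ s ∈ K', cs.simple s = u * cs.simple t * u⁻¹ → ¬ cs.IsLeftDescent v t) :
    IsMinL cs K' (u * v) := by
  apply isMinL_of
  intro s hs hd
  obtain ⟨α, hα, hαu⟩ := cs.exists_isReduced u
  obtain ⟨β, hβ, hβK, hβv⟩ := redK cs hv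
  have hw : cs.wordProd (α ++ β) = u * v := by rw [wordProd_append, ← hαu, hβv]
  obtain ⟨ρ, s1, s2, s3⟩ := exL cs (α ++ β) s (by rwa [hw])
  obtain ⟨α', β', rfl, sα, sβ⟩ := List.sublist_append_iff.1 s1
  have lα := sα.length_le
  have lβ := sβ.length_le
  have lu := hα.eq
  rw [← hαu] at lu
  have lv := hβ.eq
  rw [hβv] at lv
  simp only [List.length_append] at s2
  rw [hw, wordProd_append] at s3
  rcases lβ.lt_or_eq with hlt | heq
  · have : α' = α := sα.eq_of_length (by omega)
    subst this
    rw [← hαu] at s3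
    have hr : cs.wordProd β' * v⁻¹ ∈ WP cs K :=
      mul_mem (word_mem_WP cs _ fun j hj => hβK j (sβ.subset hj)) (inv_mem hv)
    have hur : u * (cs.wordProd β' * v⁻¹) = cs.simple s * u := by
      rw [← mul_assoc, s3]; group
    have hlen := hR.add _ hr
    rw [hur, (cs.not_isLeftDescent_iff).1 (hL.not_desc hs)] at hlen
    have hl1 : cs.length (cs.wordProd β' * v⁻¹) = 1 := by omega
    obtain ⟨γ, g1, g2, g3⟩ := redK cs hr
    have : γ.length = 1 := by rw [← g1.eq, g3, hl1]
    obtain ⟨t, rfl⟩ := List.length_eq_one_iff.1 this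
    rw [wordProd_singleton] at g3
    refine hvm t (g2 t (by simp)) s hs ?_ ?_
    · rw [g3, hur]; group
    · unfold IsLeftDescent
      rw [g3, inv_mul_cancel_right]
      have := cs.length_wordProd_le β'
      omega
  · have : β' = β := sβ.eq_of_length heq
    subst this
    rw [hβv, ← mul_assoc] at s3
    have s4 := mul_right_cancel s3
    apply hL.not_desc hs
    unfold IsLeftDescent
    rw [← s4]
    have := cs.length_wordProd_le α'
    omega

end Parabolic

section Seq

open CoxeterSystem

theorem pr_succ (u : ℕ → W) (n : ℕ) : pr u (n + 1) = pr u n * u n := by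
  simp [pr, List.range_succ]

theorem pr_zero (u : ℕ → W) : pr u 0 = 1 := by simp [pr]

/-- If `J_n = J_{n+1}`, then `J_n ⊆ J'_{n+1}`. -/
theorem SSeq.sub_of_stable [Finite B] {cs : CoxeterSystem M W} {f : B ≃ B} {e : W ≃* W}
    (hef : ∀ b, e (cs.simple b) = cs.simple (f b)) {J : Set B} (s : SSeq cs f J) (n : ℕ)
    (h : s.Jn (n + 1) = s.Jn n) : s.Jn n ⊆ s.J'n (n + 1) := by
  have hb := s.hb n
  rw [h] at hb
  set x := pr s.u (n + 1) with hx
  set K := s.Jn n with hK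
  have hsub : cs.simple '' (f '' K) ⊆ (fun y => x * y * x⁻¹) '' (cs.simple '' K) := by
    rintro _ ⟨a, ha, rfl⟩
    rw [hb] at ha
    obtain ⟨t, ht, hat⟩ := ha.2
    exact ⟨_, ⟨t, ht, rfl⟩, hat.symm⟩
  have himg : cs.simple '' (f '' K) = e '' (cs.simple '' K) := by
    rw [Set.image_image, Set.image_image]
    exact Set.image_congr fun b _ => (hef b).symm
  have hfin : (cs.simple '' K).Finite := (Set.toFinite K).image _
  have hcard : ((fun y => x * y * x⁻¹) '' (cs.simple '' K)).ncard ≤ (cs.simple '' (f '' K)).ncard := by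
    rw [himg, Set.ncard_image_of_injective _ e.injective]
    exact Set.ncard_image_le hfin
  have heq := Set.eq_of_subset_of_ncard_le hsub hcard (hfin.image _)
  intro t ht
  rw [s.hc n]
  refine ⟨ht, ?_⟩
  have : x * cs.simple t * x⁻¹ ∈ cs.simple '' (f '' K) := by
    rw [heq]; exact ⟨_, ⟨t, ht, rfl⟩, rfl⟩
  obtain ⟨a, ha, hat⟩ := this
  refine ⟨a, ha, ?_⟩
  rw [← hx, hat]; group

theorem SSeq.anti {cs : CoxeterSystem M W} {f : B ≃ B} {J : Set B} (s : SSeq cs f J) :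
    Antitone s.Jn := antitone_nat_of_succ_le s.hmono

theorem SSeq.exists_stable [Finite B] {cs : CoxeterSystem M W} {f : B ≃ B} {e : W ≃* W}
    (hef : ∀ b, e (cs.simple b) = cs.simple (f b)) {J : Set B} (s : SSeq cs f J) :
    ∃ N, ∀ n, N ≤ n → s.Jn n ⊆ s.J'n (n + 1) := by
  obtain ⟨N, hN⟩ := WellFoundedLT.antitone_chain_condition (α := Set B) s.anti
  refine ⟨N, fun n hn => s.sub_of_stable hef n ?_⟩
  rw [← hN n hn, ← hN (n + 1) (by omega)]

theorem IsMinL.mono {cs : CoxeterSystem M W} {K L : Set B} {w : W} (h : IsMinL cs K w)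
    (hL : L ⊆ K) : IsMinL cs L w := fun a ha => h a (WP_mono cs hL ha)

theorem SSeq.exists_const [Finite B] {cs : CoxeterSystem M W} {f : B ≃ B} {e : W ≃* W}
    (hef : ∀ b, e (cs.simple b) = cs.simple (f b)) {J : Set B} (s : SSeq cs f J) :
    ∃ w N, ∀ n, N ≤ n → pr s.u (n + 1) = w := by
  obtain ⟨N, hN⟩ := s.exists_stable hef
  refine ⟨pr s.u (N + 1), N, fun n hn => ?_⟩
  induction n, hn using Nat.le_induction with
  | base => rfl
  | succ n hn ih =>
    rw [pr_succ, ih, eq_one_of_mem ((s.he (n + 1)).1.mono (hN n hn)) (s.hd n), mul_one]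

/-- The tails `u_{m+1} ⋯ u_n` lie in `W_{J_m}`. -/
theorem SSeq.tail_mem {cs : CoxeterSystem M W} {f : B ≃ B} {J : Set B} (s : SSeq cs f J)
    (m n : ℕ) (h : m ≤ n) : (pr s.u (m + 1))⁻¹ * pr s.u (n + 1) ∈ WP cs (s.Jn m) := by
  induction n, h using Nat.le_induction with
  | base => simp [one_mem]
  | succ n hn ih =>
    rw [pr_succ s.u (n + 1), ← mul_assoc]
    exact mul_mem ih (WP_mono cs (s.anti hn) (s.hd n))

theorem SSeq.tail_min {cs : CoxeterSystem M W} {f : B ≃ B} {J : Set B} (s : SSeq cs f J)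
    (n k m : ℕ) (h : m + k = n) : IsMinL cs (s.J'n m) ((pr s.u m)⁻¹ * pr s.u (n + 1)) := by
  induction k generalizing m with
  | zero =>
    obtain rfl : m = n := by omega
    rw [pr_succ, inv_mul_cancel_left]
    exact (s.he m).1
  | succ k ih =>
    have ih := ih (m + 1) (by omega)
    have e1 : (pr s.u m)⁻¹ * pr s.u (n + 1) =
        s.u m * ((pr s.u (m + 1))⁻¹ * pr s.u (n + 1)) := by
      rw [pr_succ s.u m]; group
    rw [e1]
    refine minL_mul cs (s.he m).1 (s.he m).2 (s.tail_mem m n (by omega)) ?_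
    intro t ht a ha hat
    apply ih.not_desc
    rw [s.hc m]
    refine ⟨ht, ?_⟩
    cases m with
    | zero =>
      refine ⟨a, ?_, ?_⟩
      · rw [s.hJ'0] at ha; rwa [s.hJ0]
      · rw [hat, pr_succ, pr_zero]; group
    | succ m =>
      rw [s.hc m] at ha
      obtain ⟨ha1, c, hc, hac⟩ := ha
      refine ⟨c, ?_, ?_⟩
      · rw [s.hb m]
        refine ⟨hc, a, ha1, ?_⟩
        rw [hac]; group
      · have : cs.simple t = (s.u (m + 1))⁻¹ * cs.simple a * s.u (m + 1) := by rw [hat]; group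
        rw [this, hac, pr_succ s.u (m + 1)]; group

theorem minR_unique {cs : CoxeterSystem M W} {K : Set B} {u u' : W} (h : IsMinR cs K u)
    (h' : IsMinR cs K u') (hm : u⁻¹ * u' ∈ WP cs K) : u = u' := by
  by_contra hne
  have h1 := h _ hm (by simpa [eq_comm] using hne)
  have h2 := h' (u'⁻¹ * u) (by simpa using inv_mem hm) (by simpa using hne)
  simp at h1 h2
  omega

theorem SSeq.inj {cs : CoxeterSystem M W} {f : B ≃ B} {J : Set B} (s s' : SSeq cs f J)
    (w : W) (h : ∃ N, ∀ n, N ≤ n → pr s.u (n + 1) = w)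
    (h' : ∃ N, ∀ n, N ≤ n → pr s'.u (n + 1) = w) : s = s' := by
  obtain ⟨N, hN⟩ := h
  obtain ⟨N', hN'⟩ := h'
  have hu : ∀ n, s.Jn n = s'.Jn n → pr s.u n = pr s'.u n → s.u n = s'.u n := by
    intro n hJ hp
    refine minR_unique (s.he n).2 (hJ ▸ (s'.he n).2) ?_
    have a := s.tail_mem n (max n (max N N')) (by simp)
    have b := s'.tail_mem n (max n (max N N')) (by simp)
    rw [hN (max n (max N N')) (by simp)] at a
    rw [hN' (max n (max N N')) (by simp), ← hJ] at b
    have := mul_mem a (inv_mem b)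
    rw [pr_succ, pr_succ, hp] at this
    convert this using 1
    group
  have key : ∀ n, s.Jn n = s'.Jn n ∧ pr s.u n = pr s'.u n := by
    intro n
    induction n with
    | zero => exact ⟨s.hJ0.trans s'.hJ0.symm, by simp [pr_zero]⟩
    | succ n ih =>
      have hp : pr s.u (n + 1) = pr s'.u (n + 1) := by
        rw [pr_succ, pr_succ, ih.2, hu n ih.1 ih.2]
      refine ⟨?_, hp⟩
      apply f.injective.image_injective
      change f '' _ = f '' _
      rw [s.hb, s'.hb, ih.1, hp]
  have e1 : s.Jn = s'.Jn := funext fun n => (key n).1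
  have e3 : s.u = s'.u := funext fun n => hu n (key n).1 (key n).2
  have e2 : s.J'n = s'.J'n := by
    funext n
    cases n with
    | zero => rw [s.hJ'0, s'.hJ'0]
    | succ n => rw [s.hc, s'.hc, e1, e3]
  cases s; cases s'
  simp only at e1 e2 e3
  subst e1 e2 e3
  rfl

/-- A choice of minimal representative of `v W_K`. -/
noncomputable def mp (cs : CoxeterSystem M W) (K : Set B) (v : W) : W :=
  (exists_decomp cs K v).choose

theorem mp_min (cs : CoxeterSystem M W) (K : Set B) (v : W) : IsMinR cs K (mp cs K v) :=
  (exists_decomp cs K v).choose_spec.1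

theorem mp_mem (cs : CoxeterSystem M W) (K : Set B) (v : W) : (mp cs K v)⁻¹ * v ∈ WP cs K :=
  (exists_decomp cs K v).choose_spec.2

/-- The state of the inverse construction. -/
structure St (B W : Type*) where
  K : Set B
  K' : Set B
  x : W
  v : W

noncomputable def step (cs : CoxeterSystem M W) (f : B ≃ B) (S : St B W) : St B W where
  K := S.K ∩ f ⁻¹' AdSet cs (S.x * mp cs S.K S.v) S.K
  K' := S.K ∩ AdSet cs (S.x * mp cs S.K S.v)⁻¹ (f '' S.K)
  x := S.x * mp cs S.K S.v
  v := (mp cs S.K S.v)⁻¹ * S.v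

noncomputable def sts (cs : CoxeterSystem M W) (f : B ≃ B) (J : Set B) (w : W) : ℕ → St B W
  | 0 => ⟨J, f '' J, 1, w⟩
  | n + 1 => step cs f (sts cs f J w n)

noncomputable def us (cs : CoxeterSystem M W) (f : B ≃ B) (J : Set B) (w : W) (n : ℕ) : W :=
  mp cs (sts cs f J w n).K (sts cs f J w n).v

theorem sts_x (cs : CoxeterSystem M W) (f : B ≃ B) (J : Set B) (w : W) (n : ℕ) :
    (sts cs f J w n).x = pr (us cs f J w) n := by
  induction n with
  | zero => simp [sts, pr_zero]
  | succ n ih => rw [pr_succ, ← ih]; rfl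

theorem sts_inv (cs : CoxeterSystem M W) (f : B ≃ B) (J : Set B) (w : W)
    (hw : IsMinL cs (f '' J) w) (n : ℕ) :
    (sts cs f J w n).K ⊆ J ∧ (sts cs f J w n).x * (sts cs f J w n).v = w ∧
    cs.length w = cs.length (sts cs f J w n).x + cs.length (sts cs f J w n).v ∧
    IsMinL cs (sts cs f J w n).K' (sts cs f J w n).v := by
  induction n with
  | zero => simpa [sts] using hw
  | succ n ih =>
    obtain ⟨h1, h2, h3, h4⟩ := ih
    set S := sts cs f J w n with hS
    have hst : sts cs f J w (n + 1) = step cs f S := rfl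
    rw [hst]
    have hadd := (mp_min cs S.K S.v).add _ (mp_mem cs S.K S.v)
    rw [mul_inv_cancel_left] at hadd
    have hprod : (step cs f S).x * (step cs f S).v = w := by
      rw [← h2]; simp only [step]; group
    have hlen : cs.length w = cs.length (step cs f S).x + cs.length (step cs f S).v := by
      have a := cs.length_mul_le (step cs f S).x (step cs f S).v
      have b := cs.length_mul_le S.x (mp cs S.K S.v)
      rw [hprod] at a
      simp only [step] at a ⊢
      omega
    refine ⟨fun i hi => h1 hi.1, hprod, hlen, ?_⟩
    apply isMinL_of
    intro t ht hd
    obtain ⟨htK, a, ha, hat⟩ := ht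
    refine hw.not_desc (Set.image_mono h1 ha) ?_
    have e1 : cs.simple a * w = (step cs f S).x * (cs.simple t * (step cs f S).v) := by
      rw [hat, ← hprod]; simp only [step]; group
    unfold IsLeftDescent at hd ⊢
    rw [e1]
    have := cs.length_mul_le (step cs f S).x (cs.simple t * (step cs f S).v)
    omega

theorem sts_mem (cs : CoxeterSystem M W) (f : B ≃ B) (J : Set B) (w : W) (n : ℕ) :
    (sts cs f J w (n + 1)).v ∈ WP cs (sts cs f J w n).K := mp_mem cs _ _

noncomputable def mkSeq (cs : CoxeterSystem M W) (f : B ≃ B) (J : Set B) (w : W)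
    (hw : IsMinL cs (f '' J) w) : SSeq cs f J where
  Jn n := (sts cs f J w n).K
  J'n n := (sts cs f J w n).K'
  u := us cs f J w
  hJ0 := rfl
  hJ'0 := rfl
  hmono n := Set.inter_subset_left
  hb n := by
    rw [← sts_x]
    change f '' (_ ∩ f ⁻¹' _) = _
    rw [Set.image_inter_preimage]
    rfl
  hc n := by
    rw [← sts_x]
    rfl
  hd n := by
    have h1 := sts_mem cs f J w n
    have h2 := WP_mono cs (show (sts cs f J w (n + 1)).K ⊆ (sts cs f J w n).K from
      Set.inter_subset_left) (sts_mem cs f J w (n + 1))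
    have h3 : us cs f J w (n + 1) = (sts cs f J w (n + 1)).v * ((sts cs f J w (n + 1 + 1)).v)⁻¹ := by
      change us cs f J w (n + 1) = _ * ((us cs f J w (n + 1))⁻¹ * (sts cs f J w (n + 1)).v)⁻¹
      group
    rw [h3]
    exact mul_mem h1 (inv_mem h2)
  he n := by
    refine ⟨?_, mp_min cs _ _⟩
    obtain ⟨-, -, -, h4⟩ := sts_inv cs f J w hw n
    set S := sts cs f J w n with hS
    change IsMinL cs S.K' (mp cs S.K S.v)
    have hadd := (mp_min cs S.K S.v).add _ (mp_mem cs S.K S.v)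
    rw [mul_inv_cancel_left] at hadd
    apply isMinL_of
    intro t ht hd
    refine h4.not_desc ht ?_
    unfold IsLeftDescent at hd ⊢
    have := cs.length_mul_le (cs.simple t * mp cs S.K S.v) ((mp cs S.K S.v)⁻¹ * S.v)
    rw [mul_assoc, mul_inv_cancel_left] at this
    omega

theorem mkSeq_spec [Finite B] (cs : CoxeterSystem M W) (f : B ≃ B) (e : W ≃* W)
    (hef : ∀ b, e (cs.simple b) = cs.simple (f b)) (J : Set B) (w : W)
    (hw : IsMinL cs (f '' J) w) :
    ∃ N, ∀ n, N ≤ n → pr (mkSeq cs f J w hw).u (n + 1) = w := by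
  obtain ⟨N, hN⟩ := (mkSeq cs f J w hw).exists_stable hef
  refine ⟨N, fun n hn => ?_⟩
  obtain ⟨-, h2, -, h4⟩ := sts_inv cs f J w hw (n + 1)
  have h1 := eq_one_of_mem (h4.mono (hN n hn)) (sts_mem cs f J w n)
  rw [h1, mul_one, sts_x] at h2
  exact h2

end Seq

/-- Proposition 2.5: the map `(J_n, J'_n, u_n) ↦ u_0 u_1 ⋯ u_m` (`m ≫ 0`) is a
well-defined bijection `φ : S(J, ε) → {}^{J'}W`, where `J' = ε(J)`. -/
theorem statement7 [Finite B] (cs : CoxeterSystem M W) (f : B ≃ B) (e : W ≃* W)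
    (hef : ∀ b, e (cs.simple b) = cs.simple (f b)) (J J' : Set B)
    (hJ' : f '' J = J') :
    ∃ φ : SSeq cs f J → W,
      (∀ s : SSeq cs f J, ∃ N, ∀ n, N ≤ n → pr s.u (n + 1) = φ s) ∧
      (∀ s : SSeq cs f J, IsMinL cs J' (φ s)) ∧
      Function.Injective φ ∧
      (∀ w : W, IsMinL cs J' w → ∃ s : SSeq cs f J, φ s = w) := by
  subst hJ'
  choose φ hφ using fun s : SSeq cs f J => s.exists_const hef
  refine ⟨φ, hφ, ?_, ?_, ?_⟩
  · intro s
    obtain ⟨N, hN⟩ := hφ s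
    have := s.tail_min N N 0 (by omega)
    rw [pr_zero, inv_one, one_mul, hN N le_rfl, s.hJ'0] at this
    exact this
  · intro s s' h
    exact s.inj s' (φ s) (hφ s) (h ▸ hφ s')
  · intro w hw
    obtain ⟨N, hN⟩ := mkSeq_spec cs f e hef J w hw
    refine ⟨mkSeq cs f J w hw, ?_⟩
    obtain ⟨N', hN'⟩ := hφ (mkSeq cs f J w hw)
    rw [← hN' (max N N') (by simp), hN (max N N') (by simp)]

end Lusztig
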